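/- Let n ≥ 2 and β > -2/n. Then for the Gaussian beta ensemble, ⟨p₂(λ)²⟩_{β,n} = d(β,n)(d(β,n)+2), where p₂(λ) = Σ_j λ_j² and d(β,n) = n + n(n-1)β/2. -/

import Mathlib

open MeasureTheory ProbabilityTheory Real

theorem integrable_abs_rpow_mul_exp_neg_mul_sq {b : ℝ} (hb : 0 < b) {s : ℝ} (hs : -1 < s) :
    Integrable fun x : ℝ => |x| ^ s * Real.exp (-b * x ^ 2) := by
  have hpos : IntegrableOn (fun x : ℝ => |x| ^ s * Real.exp (-b * x ^ 2)) (Set.Ioi 0) :=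
    (integrableOn_rpow_mul_exp_neg_mul_sq hb hs).congr_fun
      (fun x (hx : 0 < x) => by simp only [abs_of_pos hx]) measurableSet_Ioi
  rw [← integrableOn_univ, ← Set.Iic_union_Ioi (a := (0 : ℝ)), integrableOn_union,
    integrableOn_Iic_iff_integrableOn_Iio]
  refine ⟨?_, hpos⟩
  have := hpos.comp_neg
  simpa using this

theorem integrable_comp_linearMap_of_injective {n : ℕ} (L : (Fin n → ℝ) →ₗ[ℝ] (Fin n → ℝ))
    (hL : Function.Injective L) {f : (Fin n → ℝ) → ℝ} (hf : Integrable f) :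
    Integrable fun x => f (L x) := by
  have hdet : LinearMap.det L ≠ 0 := fun h =>
    (LinearMap.bot_lt_ker_of_det_eq_zero h).ne' (LinearMap.ker_eq_bot.2 hL)
  refine Integrable.comp_measurable ?_ L.continuous_of_finiteDimensional.measurable
  rw [Measure.map_linearMap_addHaar_eq_smul_addHaar _ hdet]
  exact hf.smul_measure ENNReal.ofReal_ne_top

theorem sq_prod_lt_eq_prod_prod_ne {n : ℕ} {M : Type*} [CommMonoid M] (g : Fin n → Fin n → M)
    (hg : ∀ i j, g i j = g j i) :
    (∏ p ∈ Finset.univ.filter (fun p : Fin n × Fin n => p.1 < p.2), g p.1 p.2) ^ 2 =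
      ∏ i, ∏ j ∈ Finset.univ.erase i, g i j := by
  have hswap : ∏ p ∈ Finset.univ.filter (fun p : Fin n × Fin n => p.2 < p.1), g p.1 p.2 =
      ∏ p ∈ Finset.univ.filter (fun p : Fin n × Fin n => p.1 < p.2), g p.1 p.2 :=
    Finset.prod_bij' (fun p _ => p.swap) (fun p _ => p.swap) (by simp) (by simp) (by simp)
      (by simp) (by simp [hg])
  have hne : ∀ i : Fin n, Finset.univ.erase i = Finset.univ.filter (fun j => i ≠ j) := by
    intro i; ext j; simp [eq_comm]
  simp_rw [hne, Finset.prod_filter]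
  rw [← Finset.prod_product', Finset.univ_product_univ, sq]
  nth_rewrite 2 [← Finset.prod_filter]
  rw [← hswap, Finset.prod_filter, ← Finset.prod_mul_distrib]
  refine Finset.prod_congr rfl fun p _ => ?_
  rcases lt_trichotomy p.1 p.2 with h | h | h
  · simp [h, h.not_gt, h.ne]
  · simp [h]
  · simp [h, h.not_gt, h.ne']

theorem two_mul_card_filter_lt (n : ℕ) :
    2 * ((Finset.univ.filter (fun p : Fin n × Fin n => p.1 < p.2)).card : ℝ) = n * (n - 1) := by
  have h := sq_prod_lt_eq_prod_prod_ne (n := n) (fun _ _ => Multiplicative.ofAdd (1 : ℤ))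
    (fun _ _ => rfl)
  simp only [Finset.prod_const, Finset.card_erase_of_mem (Finset.mem_univ _), Finset.card_univ,
    Fintype.card_fin, ← ofAdd_nsmul] at h
  have h' := Multiplicative.ofAdd.injective h
  cases n with
  | zero => simp
  | succ m =>
    simp at h'
    have : 2 * ((Finset.univ.filter (fun p : Fin (m + 1) × Fin (m + 1) => p.1 < p.2)).card : ℝ)
      = (m + 1) * m := by exact_mod_cast h'
    rw [this]; push_cast; ring

/-- The vector `x` with every coordinate other than the `i`-th measured from `x i`. -/
def shearFrom {n : ℕ} (i : Fin n) : (Fin n → ℝ) →ₗ[ℝ] (Fin n → ℝ) where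
  toFun x j := if j = i then x i else x j - x i
  map_add' x y := by ext j; by_cases h : j = i <;> simp [h]; ring
  map_smul' c x := by ext j; by_cases h : j = i <;> simp [h]; ring

theorem shearFrom_injective {n : ℕ} (i : Fin n) : Function.Injective (shearFrom i) := by
  intro x y h
  have hi : x i = y i := by simpa [shearFrom] using congrFun h i
  ext j
  have := congrFun h j
  by_cases hj : j = i <;> simp_all [shearFrom]

theorem integrable_star_mul_exp {n : ℕ} (i : Fin n) {b : ℝ} (hb : -1 < b) :
    Integrable fun x : Fin n → ℝ =>
      (∏ j ∈ Finset.univ.erase i, |x j - x i| ^ b) * Real.exp (-(∑ j, x j ^ 2) / 2) := by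
  set c : ℝ := 1 / (2 * (2 * n + 3)) with hc
  have hc0 : 0 < c := by positivity
  have hprod : Integrable fun y : Fin n → ℝ =>
      ∏ j, |y j| ^ (if j = i then 0 else b) * Real.exp (-c * y j ^ 2) :=
    Integrable.fintype_prod (f := fun j (t : ℝ) => |t| ^ (if j = i then 0 else b) *
      Real.exp (-c * t ^ 2)) fun j => integrable_abs_rpow_mul_exp_neg_mul_sq hc0 (by
        split_ifs <;> linarith)
  refine (integrable_comp_linearMap_of_injective _ (shearFrom_injective i) hprod).mono'
    (Measurable.aestronglyMeasurable (by fun_prop)) (.of_forall fun x => ?_)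
  rw [Real.norm_of_nonneg (by positivity), Finset.prod_mul_distrib, ← Real.exp_sum,
    ← Finset.mul_prod_erase Finset.univ (fun j => |shearFrom i x j| ^ (if j = i then 0 else b))
      (Finset.mem_univ i)]
  have hfac : ∏ j ∈ Finset.univ.erase i, |shearFrom i x j| ^ (if j = i then 0 else b) =
      ∏ j ∈ Finset.univ.erase i, |x j - x i| ^ b :=
    Finset.prod_congr rfl fun j hj => by simp [shearFrom, Finset.ne_of_mem_erase hj]
  rw [hfac, if_pos rfl, Real.rpow_zero, one_mul]
  refine mul_le_mul_of_nonneg_left (Real.exp_le_exp.2 ?_) (by positivity)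
  rw [← Finset.mul_sum]
  have hterm : ∀ j, shearFrom i x j ^ 2 ≤ 2 * x j ^ 2 + 2 * x i ^ 2 := by
    intro j
    by_cases hj : j = i
    · simp [shearFrom, hj]; nlinarith [sq_nonneg (x i)]
    · simp [shearFrom, hj]; nlinarith [sq_nonneg (x j + x i)]
  have hi : x i ^ 2 ≤ ∑ j, x j ^ 2 :=
    Finset.single_le_sum (f := fun j => x j ^ 2) (fun j _ => sq_nonneg _) (Finset.mem_univ i)
  have hsum : ∑ j, shearFrom i x j ^ 2 ≤ (2 * n + 3) * ∑ j, x j ^ 2 := by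
    calc _ ≤ ∑ j, (2 * x j ^ 2 + 2 * x i ^ 2) := Finset.sum_le_sum fun j _ => hterm j
      _ = 2 * ∑ j, x j ^ 2 + n * (2 * x i ^ 2) := by
        rw [Finset.sum_add_distrib, ← Finset.mul_sum]; simp
      _ ≤ _ := by nlinarith [sq_nonneg (x i), mul_le_mul_of_nonneg_left hi n.cast_nonneg (α := ℝ)]
  have h1 := mul_le_mul_of_nonneg_left hsum hc0.le
  have h2 : c * ((2 * n + 3) * ∑ j, x j ^ 2) = (∑ j, x j ^ 2) / 2 := by
    rw [hc]; field_simp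
  linarith

theorem abs_vandermonde_rpow_le {n : ℕ} (hn : 0 < n) (β : ℝ) (x : Fin n → ℝ) :
    |∏ p ∈ Finset.univ.filter (fun p : Fin n × Fin n => p.1 < p.2), (x p.2 - x p.1)| ^ β ≤
      ∑ i, (n : ℝ)⁻¹ * ∏ j ∈ Finset.univ.erase i, |x j - x i| ^ (β * n / 2) := by
  have hn' : (n : ℝ) ≠ 0 := by positivity
  refine le_of_eq_of_le ?_ (Real.geom_mean_le_arith_mean_weighted Finset.univ
    (fun _ => (n : ℝ)⁻¹) (fun i => ∏ j ∈ Finset.univ.erase i, |x j - x i| ^ (β * n / 2))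
    (fun _ _ => by positivity) (by simp [hn']) fun _ _ => by positivity)
  have h := sq_prod_lt_eq_prod_prod_ne (fun i j => |x j - x i| ^ (β / 2))
    (fun i j => by rw [abs_sub_comm])
  rw [Finset.abs_prod, ← Real.finsetProd_rpow _ _ fun _ _ => abs_nonneg _]
  trans (∏ p ∈ Finset.univ.filter (fun p : Fin n × Fin n => p.1 < p.2),
    |x p.2 - x p.1| ^ (β / 2)) ^ 2
  · rw [← Finset.prod_pow]
    refine Finset.prod_congr rfl fun p _ => ?_
    rw [← Real.rpow_mul_natCast (abs_nonneg _)]; congr 1; push_cast; ring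
  · rw [h]
    refine Finset.prod_congr rfl fun i _ => ?_
    rw [← Real.finsetProd_rpow _ _ fun _ _ => by positivity]
    refine Finset.prod_congr rfl fun j _ => ?_
    rw [← Real.rpow_mul (abs_nonneg _)]; congr 1; field_simp

/-- The unnormalized density of the Gaussian `β`-ensemble. -/
noncomputable def gbeWeight (n : ℕ) (β : ℝ) (l : Fin n → ℝ) : ℝ :=
  |∏ p ∈ Finset.univ.filter (fun p : Fin n × Fin n => p.1 < p.2), (l p.2 - l p.1)| ^ β
    * Real.exp (-(∑ j, l j ^ 2) / 2)

theorem gbeWeight_nonneg (n : ℕ) (β : ℝ) (l : Fin n → ℝ) : 0 ≤ gbeWeight n β l := by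
  unfold gbeWeight; positivity

theorem measurable_gbeWeight (n : ℕ) (β : ℝ) : Measurable (gbeWeight n β) := by
  unfold gbeWeight; fun_prop

theorem integrable_gbeWeight {n : ℕ} (hn : 0 < n) {β : ℝ} (hβ : -2 / n < β) :
    Integrable (gbeWeight n β) := by
  have hb : -1 < β * n / 2 := by
    have hn' : (0 : ℝ) < n := by positivity
    rw [div_lt_iff₀ hn'] at hβ
    linarith
  refine (integrable_finsetSum Finset.univ fun i _ =>
    (integrable_star_mul_exp (n := n) i hb).const_mul (n : ℝ)⁻¹).mono'
    (measurable_gbeWeight n β).aestronglyMeasurable (.of_forall fun x => ?_)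
  rw [Real.norm_of_nonneg (gbeWeight_nonneg n β x)]
  simp_rw [← mul_assoc, ← Finset.sum_mul]
  exact mul_le_mul_of_nonneg_right (abs_vandermonde_rpow_le hn β x) (Real.exp_nonneg _)

theorem integral_gbeWeight_pos {n : ℕ} (hn : 0 < n) {β : ℝ} (hβ : -2 / n < β) :
    0 < ∫ l, gbeWeight n β l := by
  rw [integral_pos_iff_support_of_nonneg (gbeWeight_nonneg n β) (integrable_gbeWeight hn hβ)]
  let U : Set (Fin n → ℝ) :=
    {l | ∏ p ∈ Finset.univ.filter (fun p : Fin n × Fin n => p.1 < p.2), (l p.2 - l p.1) ≠ 0}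
  have hU : IsOpen U := isOpen_ne_fun (by fun_prop) continuous_const
  refine (hU.measure_pos volume ⟨fun i => (i : ℝ), ?_⟩).trans_le (measure_mono fun l hl => ?_)
  · refine Finset.prod_ne_zero_iff.2 fun p hp => ?_
    have hlt : p.1 < p.2 := by simpa using hp
    exact (sub_pos.2 (Nat.cast_lt.2 (Fin.lt_def.1 hlt))).ne'
  · exact (mul_pos (Real.rpow_pos_of_pos (abs_pos.2 hl) β) (Real.exp_pos _)).ne'

theorem gbeWeight_smul (n : ℕ) (β : ℝ) {c : ℝ} (hc : 0 < c) (l : Fin n → ℝ) :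
    gbeWeight n β (c • l) =
      c ^ (n * (n - 1) * β / 2) *
        (Real.exp ((1 - c ^ 2) / 2 * ∑ j, l j ^ 2) * gbeWeight n β l) := by
  simp only [gbeWeight, Pi.smul_apply, smul_eq_mul, ← mul_sub, Finset.prod_mul_distrib,
    Finset.prod_const, mul_pow, ← Finset.mul_sum]
  have hexp : Real.exp (-(c ^ 2 * ∑ j, l j ^ 2) / 2) =
      Real.exp ((1 - c ^ 2) / 2 * ∑ j, l j ^ 2) * Real.exp (-(∑ j, l j ^ 2) / 2) := by
    rw [← Real.exp_add]; congr 1; ring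
  rw [abs_mul, abs_of_pos (pow_pos hc _), Real.mul_rpow (pow_nonneg hc.le _) (abs_nonneg _),
    ← Real.rpow_natCast_mul hc.le, hexp, ← two_mul_card_filter_lt n,
    mul_assoc 2, mul_div_cancel_left₀ _ two_ne_zero]
  ring

theorem exp_mul_gbeWeight_eq (n : ℕ) (β : ℝ) {t : ℝ} (ht : t < 1 / 2) (l : Fin n → ℝ) :
    Real.exp (t * ∑ j, l j ^ 2) * gbeWeight n β l =
      √(1 - 2 * t) ^ (-(n * (n - 1) * β / 2)) * gbeWeight n β (√(1 - 2 * t) • l) := by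
  have hc : 0 < √(1 - 2 * t) := Real.sqrt_pos.2 (by linarith)
  rw [gbeWeight_smul n β hc, ← mul_assoc, ← Real.rpow_add hc, neg_add_cancel, Real.rpow_zero,
    one_mul, Real.sq_sqrt (by linarith)]
  congr 3; ring

theorem integrable_exp_mul_gbeWeight {n : ℕ} (hn : 0 < n) {β : ℝ} (hβ : -2 / n < β) {t : ℝ}
    (ht : t < 1 / 2) :
    Integrable fun l => Real.exp (t * ∑ j, l j ^ 2) * gbeWeight n β l := by
  have hc : 0 < √(1 - 2 * t) := Real.sqrt_pos.2 (by linarith)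
  simp_rw [exp_mul_gbeWeight_eq n β ht]
  exact ((integrable_comp_smul_iff volume _ hc.ne').2 (integrable_gbeWeight hn hβ)).const_mul _

theorem integral_exp_mul_gbeWeight (n : ℕ) (β : ℝ) {t : ℝ} (ht : t < 1 / 2) :
    ∫ l, Real.exp (t * ∑ j, l j ^ 2) * gbeWeight n β l =
      (1 - 2 * t) ^ (-(n + n * (n - 1) * β / 2) / 2) * ∫ l, gbeWeight n β l := by
  have hc : 0 < √(1 - 2 * t) := Real.sqrt_pos.2 (by linarith)
  simp_rw [exp_mul_gbeWeight_eq n β ht]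
  rw [integral_const_mul, Measure.integral_comp_smul, Module.finrank_fin_fun, smul_eq_mul,
    abs_of_pos (by positivity), ← Real.rpow_natCast, ← Real.rpow_neg hc.le, ← mul_assoc,
    ← Real.rpow_add hc, Real.sqrt_eq_rpow, ← Real.rpow_mul (by linarith)]
  congr 2; ring

theorem iteratedDeriv_two_one_sub_two_mul_rpow (a : ℝ) :
    iteratedDeriv 2 (fun t : ℝ => (1 - 2 * t) ^ (-a / 2)) 0 = a * (a + 2) := by
  have hderiv : ∀ (r : ℝ) {t : ℝ}, t < 1 / 2 →
      HasDerivAt (fun t : ℝ => (1 - 2 * t) ^ r) (-2 * r * (1 - 2 * t) ^ (r - 1)) t := by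
    intro r t ht
    have h : HasDerivAt (fun t : ℝ => 1 - 2 * t) (-2) t := by
      simpa using ((hasDerivAt_id t).const_mul 2).const_sub 1
    exact h.rpow_const (Or.inl (by linarith))
  rw [iteratedDeriv_succ, iteratedDeriv_one]
  have heq : deriv (fun t : ℝ => (1 - 2 * t) ^ (-a / 2)) =ᶠ[nhds 0]
      fun t => -2 * (-a / 2) * (1 - 2 * t) ^ (-a / 2 - 1) := by
    filter_upwards [Iio_mem_nhds (show (0 : ℝ) < 1 / 2 by norm_num)] with t ht
    exact (hderiv _ ht).deriv
  rw [heq.deriv_eq, ((hderiv (-a / 2 - 1) (by norm_num)).const_mul _).deriv]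
  simp; ring

/-- `⟨p₂(λ)²⟩_{β,n} = d(β,n)(d(β,n)+2)`. -/
theorem gbe_p2_sq_mean (n : ℕ) (hn : 2 ≤ n) (β : ℝ) (hβ : -2 / n < β)
    (Z : ℝ) (μ : Measure (Fin n → ℝ))
    (hZ : Z = ∫ l : Fin n → ℝ,
      |∏ p ∈ Finset.univ.filter (fun p : Fin n × Fin n => p.1 < p.2), (l p.2 - l p.1)| ^ β
        * Real.exp (-(∑ j, l j ^ 2) / 2))
    (hμ : μ = (volume : Measure (Fin n → ℝ)).withDensity fun l =>
      ENNReal.ofReal (Z⁻¹ *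
        (|∏ p ∈ Finset.univ.filter (fun p : Fin n × Fin n => p.1 < p.2), (l p.2 - l p.1)| ^ β
          * Real.exp (-(∑ j, l j ^ 2) / 2)))) :
    (∫ l, (∑ j, l j ^ 2) ^ 2 ∂μ) = (n + n * (n - 1) * β / 2) * (n + n * (n - 1) * β / 2 + 2) := by
  change Z = ∫ l, gbeWeight n β l at hZ
  change μ = volume.withDensity fun l => ENNReal.ofReal (Z⁻¹ * gbeWeight n β l) at hμ
  have hn0 : 0 < n := by omega
  have hZ0 : 0 < Z := hZ ▸ integral_gbeWeight_pos hn0 hβ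
  have hmeas : Measurable fun l : Fin n → ℝ => ENNReal.ofReal (Z⁻¹ * gbeWeight n β l) :=
    ((measurable_gbeWeight n β).const_mul _).ennreal_ofReal
  have htoReal : ∀ l : Fin n → ℝ,
      (ENNReal.ofReal (Z⁻¹ * gbeWeight n β l)).toReal = Z⁻¹ * gbeWeight n β l := fun l =>
    ENNReal.toReal_ofReal (mul_nonneg (inv_nonneg.2 hZ0.le) (gbeWeight_nonneg n β l))
  have hset : Set.Iio (1 / 2) ⊆ integrableExpSet (fun l : Fin n → ℝ => ∑ j, l j ^ 2) μ := by
    intro t ht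
    rw [integrableExpSet, Set.mem_ofPred_eq, hμ, integrable_withDensity_iff_integrable_smul' hmeas
      (.of_forall fun _ => ENNReal.ofReal_lt_top)]
    simp_rw [htoReal, smul_eq_mul, mul_assoc, mul_comm (gbeWeight n β _)]
    exact (integrable_exp_mul_gbeWeight hn0 hβ ht).const_mul _
  have hmgf : mgf (fun l : Fin n → ℝ => ∑ j, l j ^ 2) μ =ᶠ[nhds 0]
      fun t => (1 - 2 * t) ^ (-(n + n * (n - 1) * β / 2) / 2) := by
    filter_upwards [Iio_mem_nhds (show (0 : ℝ) < 1 / 2 by norm_num)] with t ht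
    rw [mgf, hμ, integral_withDensity_eq_integral_toReal_smul hmeas
      (.of_forall fun _ => ENNReal.ofReal_lt_top)]
    simp_rw [htoReal, smul_eq_mul, mul_assoc, mul_comm (gbeWeight n β _)]
    rw [integral_const_mul, integral_exp_mul_gbeWeight n β ht, ← hZ]
    field_simp
  have hderiv := iteratedDeriv_mgf_zero
    (interior_maximal hset isOpen_Iio (show (0 : ℝ) ∈ Set.Iio (1 / 2) by norm_num)) 2
  rw [hmgf.iteratedDeriv_eq, iteratedDeriv_two_one_sub_two_mul_rpow] at hderiv
  simpa using hderiv.symm
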